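/- Let A be a weakly associative relation algebra and let x be an atom of A. Then dom(x) = (x;x⌣)·1' and rng(x) = (x⌣;x)·1' are atoms of A. -/

import Mathlib

universe u

/-- A weakly associative relation algebra: a Boolean algebra equipped with
relative multiplication `comp`, converse `conv`, and identity `one'`
satisfying the WA axioms. -/
structure WA (A : Type*) [BooleanAlgebra A] where
  comp : A → A → A
  conv : A → A
  one' : A
  wassoc : ∀ x : A, comp (comp (x ⊓ one') ⊤) ⊤ = comp (x ⊓ one') ⊤
  rdist : ∀ x y z : A, comp (x ⊔ y) z = comp x z ⊔ comp y z
  comp_one' : ∀ x : A, comp x one' = x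
  conv_conv : ∀ x : A, conv (conv x) = x
  conv_sup : ∀ x y : A, conv (x ⊔ y) = conv x ⊔ conv y
  conv_comp : ∀ x y : A, conv (comp x y) = comp (conv y) (conv x)
  tarski : ∀ x y : A, comp (conv x) (comp x y)ᶜ ≤ yᶜ

/-- `dom(x) = (x;x⌣)·1'`. -/
def Dom {A : Type u} [BooleanAlgebra A] (W : WA A) (x : A) : A :=
  W.comp x (W.conv x) ⊓ W.one'

/-- `rng(x) = (x⌣;x)·1'`. -/
def Rng {A : Type u} [BooleanAlgebra A] (W : WA A) (x : A) : A :=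
  W.comp (W.conv x) x ⊓ W.one'

namespace WA

variable {A : Type u} [BooleanAlgebra A] (W : WA A)

theorem conv_mono {x y : A} (h : x ≤ y) : W.conv x ≤ W.conv y := by
  rw [← sup_eq_right] at h ⊢
  rw [← W.conv_sup, h]

theorem conv_le_iff {x y : A} : W.conv x ≤ y ↔ x ≤ W.conv y :=
  ⟨fun h => by simpa only [W.conv_conv] using W.conv_mono h,
    fun h => by simpa only [W.conv_conv] using W.conv_mono h⟩

/-- Converse as an order automorphism. -/
def convIso : A ≃o A where
  toFun := W.conv
  invFun := W.conv
  left_inv := W.conv_conv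
  right_inv := W.conv_conv
  map_rel_iff' {x y} := by
    rw [Equiv.coe_fn_mk, W.conv_le_iff, W.conv_conv]

theorem isAtom_conv {x : A} (hx : IsAtom x) : IsAtom (W.conv x) :=
  (W.convIso.isAtom_iff x).2 hx

theorem disjoint_conv {x y : A} (h : Disjoint x y) :
    Disjoint (W.conv x) (W.conv y) :=
  (disjoint_map_orderIso_iff W.convIso).2 h

theorem comp_mono_left {x y : A} (h : x ≤ y) (z : A) : W.comp x z ≤ W.comp y z := by
  rw [← sup_eq_right] at h ⊢
  rw [← W.rdist, h]

theorem comp_mono_right (x : A) {y z : A} (h : y ≤ z) : W.comp x y ≤ W.comp x z := by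
  have := W.conv_mono (W.comp_mono_left (W.conv_mono h) (W.conv x))
  simpa only [W.conv_comp, W.conv_conv] using this

theorem conv_one' : W.conv W.one' = W.one' := by
  have h := W.conv_comp (W.conv W.one') W.one'
  simpa only [W.comp_one', W.conv_conv] using h.symm

theorem one'_comp (x : A) : W.comp W.one' x = x := by
  have h := W.conv_comp (W.conv x) W.one'
  simpa only [W.comp_one', W.conv_conv, W.conv_one'] using h.symm

theorem conv_top : W.conv ⊤ = ⊤ :=
  W.convIso.map_top

theorem disjoint_conv_comp {x y z : A} (h : Disjoint (W.comp x y) z) :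
    Disjoint (W.comp (W.conv x) z) y :=
  le_compl_iff_disjoint_right.1
    ((W.comp_mono_right _ (le_compl_iff_disjoint_left.2 h)).trans (W.tarski x y))

theorem disjoint_comp_conv {x y z : A} (h : Disjoint (W.comp x y) z) :
    Disjoint (W.comp z (W.conv y)) x := by
  have h' := W.disjoint_conv h
  rw [W.conv_comp] at h'
  simpa only [W.conv_comp, W.conv_conv] using W.disjoint_conv (W.disjoint_conv_comp h')

theorem comp_le_right {a : A} (ha : a ≤ W.one') (x : A) : W.comp a x ≤ x :=
  (W.comp_mono_left ha x).trans_eq (W.one'_comp x)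

theorem comp_le_left {a : A} (ha : a ≤ W.one') (x : A) : W.comp x a ≤ x :=
  (W.comp_mono_right x ha).trans_eq (W.comp_one' x)

theorem le_conv_of_le_one' {a : A} (ha : a ≤ W.one') : a ≤ W.conv a := by
  have hc : a \ W.conv a ≤ W.one' := sdiff_le.trans ha
  have hc' : W.conv (a \ W.conv a) ≤ W.one' :=
    (W.conv_mono hc).trans_eq W.conv_one'
  have hd : Disjoint (W.conv (a \ W.conv a)) (a \ W.conv a) :=
    disjoint_sdiff_self_right.mono_left (W.conv_mono sdiff_le)
  have h0 : W.comp (W.conv (a \ W.conv a)) (a \ W.conv a) = ⊥ :=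
    le_bot_iff.1 (hd (W.comp_le_left hc _) (W.comp_le_right hc' _))
  have h1 : Disjoint (W.comp (W.conv (a \ W.conv a)) (a \ W.conv a)) W.one' :=
    h0 ▸ disjoint_bot_left
  have h2 := W.disjoint_conv_comp h1
  rw [W.conv_conv, W.comp_one', disjoint_self] at h2
  exact sdiff_eq_bot_iff.1 h2

theorem conv_eq_of_le_one' {a : A} (ha : a ≤ W.one') : W.conv a = a :=
  le_antisymm (W.conv_le_iff.2 (W.le_conv_of_le_one' ha)) (W.le_conv_of_le_one' ha)

theorem disjoint_comp_top {a b : A} (ha : a ≤ W.one') (hb : b ≤ W.one')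
    (hab : Disjoint a b) : Disjoint (W.comp a ⊤) (W.comp b ⊤) := by
  have h0 : W.comp a b = ⊥ :=
    le_bot_iff.1 (hab (W.comp_le_left hb _) (W.comp_le_right ha _))
  have h1 : Disjoint (W.comp a b) ⊤ := h0 ▸ disjoint_bot_left
  have h2 := W.disjoint_conv_comp h1
  have hw := W.wassoc a
  rw [inf_eq_left.2 ha] at hw
  rw [W.conv_eq_of_le_one' ha, ← hw] at h2
  simpa only [W.conv_top] using (W.disjoint_comp_conv h2).symm

theorem le_comp_of_le_dom {x a : A} (hx : IsAtom x) (ha : a ≤ Dom W x) (h0 : a ≠ ⊥) :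
    x ≤ W.comp a x := by
  by_contra h
  have hd : Disjoint (W.comp a x) x := (hx.not_le_iff_disjoint.1 h).symm
  exact h0 ((W.disjoint_comp_conv hd).eq_bot_of_ge (ha.trans inf_le_left))

theorem isAtom_dom {x : A} (hx : IsAtom x) : IsAtom (Dom W x) := by
  refine ⟨fun h => hx.1 ?_, fun a ha => ?_⟩
  · have h2 := W.disjoint_comp_conv (disjoint_iff.2 h)
    rwa [W.conv_conv, W.one'_comp, disjoint_self] at h2
  · by_contra h0
    have hb0 : Dom W x \ a ≠ ⊥ := fun h => ha.not_ge (sdiff_eq_bot_iff.1 h)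
    have hd := W.disjoint_comp_top (ha.le.trans inf_le_right)
      ((sdiff_le (b := a)).trans (inf_le_right : Dom W x ≤ _)) disjoint_sdiff_self_right
    exact hx.1 (le_bot_iff.1 (hd
      ((W.le_comp_of_le_dom hx ha.le h0).trans (W.comp_mono_right _ le_top))
      ((W.le_comp_of_le_dom hx sdiff_le hb0).trans (W.comp_mono_right _ le_top))))

theorem dom_conv (x : A) : Dom W (W.conv x) = Rng W x := by
  rw [Dom, Rng, W.conv_conv]

end WA

/-- If `x` is an atom of a WA, then `dom(x)` and `rng(x)` are atoms. -/
theorem stmt_15 {A : Type u} [BooleanAlgebra A] (W : WA A)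
    (x : A) (hx : IsAtom x) :
    IsAtom (Dom W x) ∧ IsAtom (Rng W x) := by
  exact ⟨W.isAtom_dom hx, W.dom_conv x ▸ W.isAtom_dom (W.isAtom_conv hx)⟩
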